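/- Assume (H1)–(H3), let α > 0 and let w^α be a continuous space-time periodic viscosity solution of w^α_t + G(x,y,t,D_x w^α, D_y w^α) + α w^α = 0 on ℝⁿ×ℝ×ℝ. If l < 0 in (H3), then for every fixed (x,t) the function y ↦ w^α(x,y,t) + l y is nonincreasing on ℝ; if l > 0, then for every fixed (x,t) the function y ↦ w^α(x,y,t) + l y is nondecreasing on ℝ. -/

import Mathlib

open MeasureTheory Topology Filter
open scoped RealInnerProductSpace

noncomputable section

/-- Euclidean space ℝⁿ. -/
abbrev Euc (n : ℕ) := EuclideanSpace ℝ (Fin n)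

/-- Hamiltonians G = G(x, y, t, p_x, p_y). -/
abbrev Ham (n : ℕ) := Euc n → ℝ → ℝ → Euc n → ℝ → ℝ

/-- The space of points (x, y, t) ∈ ℝⁿ×ℝ×ℝ. -/
abbrev Dom (n : ℕ) := Euc n × ℝ × ℝ

/-- The space of points ξ = (x, y, t, p_x, p_y). -/
abbrev Xi (n : ℕ) := Euc n × ℝ × ℝ × Euc n × ℝ

/-- The space of points (x, t) ∈ ℝⁿ×ℝ. -/
abbrev Dom2 (n : ℕ) := Euc n × ℝ

/-- The integer vector k viewed as a point of ℝⁿ. -/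
def intVec {n : ℕ} (k : Fin n → ℤ) : Euc n := WithLp.toLp 2 (fun i => (k i : ℝ))

/-- ∂φ/∂t for φ = φ(x,y,t). -/
def pdT {n : ℕ} (φ : Dom n → ℝ) (z : Dom n) : ℝ := fderiv ℝ φ z (0, 0, 1)

/-- ∂φ/∂y for φ = φ(x,y,t). -/
def pdY {n : ℕ} (φ : Dom n → ℝ) (z : Dom n) : ℝ := fderiv ℝ φ z (0, 1, 0)

/-- D_x φ for φ = φ(x,y,t). -/
def pdX {n : ℕ} (φ : Dom n → ℝ) (z : Dom n) : Euc n :=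
  WithLp.toLp 2 (fun i => fderiv ℝ φ z (EuclideanSpace.single i 1, 0, 0))

/-- ∂φ/∂t for φ = φ(x,t). -/
def pdT2 {n : ℕ} (φ : Dom2 n → ℝ) (z : Dom2 n) : ℝ := fderiv ℝ φ z (0, 1)

/-- D_x φ for φ = φ(x,t). -/
def pdX2 {n : ℕ} (φ : Dom2 n → ℝ) (z : Dom2 n) : Euc n :=
  WithLp.toLp 2 (fun i => fderiv ℝ φ z (EuclideanSpace.single i 1, 0))

/-- Viscosity subsolution of `w_t + G(x,y,t,D_x w,D_y w) + α w = λ` on ℝⁿ×ℝ×ℝ. -/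
def ViscSub {n : ℕ} (G : Ham n) (α lam : ℝ) (u : Dom n → ℝ) : Prop :=
  UpperSemicontinuous u ∧
  ∀ φ : Dom n → ℝ, ContDiff ℝ 1 φ → ∀ z : Dom n,
    IsLocalMax (fun w => u w - φ w) z →
    pdT φ z + G z.1 z.2.1 z.2.2 (pdX φ z) (pdY φ z) + α * u z ≤ lam

/-- Viscosity supersolution of `w_t + G(x,y,t,D_x w,D_y w) + α w = λ` on ℝⁿ×ℝ×ℝ. -/
def ViscSuper {n : ℕ} (G : Ham n) (α lam : ℝ) (u : Dom n → ℝ) : Prop :=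
  LowerSemicontinuous u ∧
  ∀ φ : Dom n → ℝ, ContDiff ℝ 1 φ → ∀ z : Dom n,
    IsLocalMin (fun w => u w - φ w) z →
    lam ≤ pdT φ z + G z.1 z.2.1 z.2.2 (pdX φ z) (pdY φ z) + α * u z

/-- Viscosity solution of `w_t + G(x,y,t,D_x w,D_y w) + α w = λ` on ℝⁿ×ℝ×ℝ. -/
def ViscSol {n : ℕ} (G : Ham n) (α lam : ℝ) (u : Dom n → ℝ) : Prop :=
  Continuous u ∧ ViscSub G α lam u ∧ ViscSuper G α lam u

/-- ℤⁿ-periodicity in x, 1-periodicity in y and t. -/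
def STPeriodic {n : ℕ} (u : Dom n → ℝ) : Prop :=
  (∀ (k : Fin n → ℤ) (x : Euc n) (y t : ℝ), u (x + intVec k, y, t) = u (x, y, t)) ∧
  (∀ x y t, u (x, y + 1, t) = u (x, y, t)) ∧
  (∀ x y t, u (x, y, t + 1) = u (x, y, t))

/-- Boundedness of a function on ℝⁿ×ℝ×ℝ. -/
def Bdd {n : ℕ} (u : Dom n → ℝ) : Prop := ∃ M, ∀ z, |u z| ≤ M

/-- (H1) : continuity and periodicity of the Hamiltonian. -/
def HypH1 {n : ℕ} (G : Ham n) : Prop :=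
  Continuous (fun ξ : Xi n => G ξ.1 ξ.2.1 ξ.2.2.1 ξ.2.2.2.1 ξ.2.2.2.2) ∧
  (∀ (k : Fin n → ℤ) x y t px py, G (x + intVec k) y t px py = G x y t px py) ∧
  (∀ x y t px py, G x (y + 1) t px py = G x y t px py) ∧
  (∀ x y t px py, G x y (t + 1) px py = G x y t px py)

/-- (H2) : coercivity in p_x at p_y = 0, with constants C₁, C₂ > 0. -/
def HypH2 {n : ℕ} (G : Ham n) (C₁ C₂ : ℝ) : Prop :=
  0 < C₁ ∧ 0 < C₂ ∧ ∀ x y t px, C₁ * ‖px‖ - C₂ ≤ G x y t px 0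

/-- (H2') : coercivity in p_x, locally uniformly in p_y. -/
def HypH2' {n : ℕ} (F : Ham n) : Prop :=
  ∀ R : ℝ, 0 < R → ∃ C₁ C₂ : ℝ, 0 < C₁ ∧ 0 < C₂ ∧
    ∀ x y t px py, |py| ≤ R → C₁ * ‖px‖ - C₂ ≤ F x y t px py

/-- (H3) : local Lipschitz continuity in (y,t,p_y) and a.e. bounds on the
partial derivatives ∂_y G, ∂_t G, ∂_{p_y} G. -/
def HypH3 {n : ℕ} (G : Ham n) (l C₃ C₄ C₅ : ℝ) : Prop :=
  0 ≤ C₃ ∧ 0 ≤ C₄ ∧ 0 ≤ C₅ ∧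
  (∀ (x px : Euc n), LocallyLipschitz (fun q : ℝ × ℝ × ℝ => G x q.1 q.2.1 px q.2.2)) ∧
  (∀ᵐ ξ ∂(volume : Measure (Xi n)),
    |deriv (fun y => G ξ.1 y ξ.2.2.1 ξ.2.2.2.1 ξ.2.2.2.2) ξ.2.1| ≤ C₃ * |ξ.2.2.2.2 + l| ∧
    |deriv (fun t => G ξ.1 ξ.2.1 t ξ.2.2.2.1 ξ.2.2.2.2) ξ.2.2.1| ≤
      C₄ * (1 + |ξ.2.2.2.2| + |G ξ.1 ξ.2.1 ξ.2.2.1 ξ.2.2.2.1 ξ.2.2.2.2|) ∧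
    |deriv (fun py => G ξ.1 ξ.2.1 ξ.2.2.1 ξ.2.2.2.1 py) ξ.2.2.2.2| ≤ C₅)

/-- λ is an ergodic constant : bounded usc subsolution and bounded lsc
supersolution of `w_t + G = λ` exist. -/
def ErgodicConst {n : ℕ} (G : Ham n) (lam : ℝ) : Prop :=
  (∃ u, Bdd u ∧ ViscSub G 0 lam u) ∧ (∃ v, Bdd v ∧ ViscSuper G 0 lam v)

/-- λ solves the cell problem at (p_x,p_y) : the equation
`v_t + F(x,y,t,p_x + D_x v, p_y + D_y v) = λ` has a bounded space-time periodic
usc subsolution and a bounded space-time periodic lsc supersolution. -/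
def CellOk {n : ℕ} (F : Ham n) (px : Euc n) (py lam : ℝ) : Prop :=
  (∃ u, Bdd u ∧ STPeriodic u ∧
    ViscSub (fun x y t qx qy => F x y t (px + qx) (py + qy)) 0 lam u) ∧
  (∃ v, Bdd v ∧ STPeriodic v ∧
    ViscSuper (fun x y t qx qy => F x y t (px + qx) (py + qy)) 0 lam v)

/-- Viscosity subsolution of `w_t + G(x,y,t,D_x w,D_y w) = 0` on ℝⁿ×ℝ×(0,∞). -/
def ViscSubPos {n : ℕ} (G : Ham n) (u : Dom n → ℝ) : Prop :=
  ∀ φ : Dom n → ℝ, ContDiff ℝ 1 φ → ∀ z : Dom n, 0 < z.2.2 →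
    IsLocalMax (fun w => u w - φ w) z →
    pdT φ z + G z.1 z.2.1 z.2.2 (pdX φ z) (pdY φ z) ≤ 0

/-- Viscosity supersolution of `w_t + G(x,y,t,D_x w,D_y w) = 0` on ℝⁿ×ℝ×(0,∞). -/
def ViscSuperPos {n : ℕ} (G : Ham n) (u : Dom n → ℝ) : Prop :=
  ∀ φ : Dom n → ℝ, ContDiff ℝ 1 φ → ∀ z : Dom n, 0 < z.2.2 →
    IsLocalMin (fun w => u w - φ w) z →
    0 ≤ pdT φ z + G z.1 z.2.1 z.2.2 (pdX φ z) (pdY φ z)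

/-- Bounded uniformly continuous (on every slab ℝⁿ×ℝ×[0,T]) viscosity solution of the
initial value problem `v_t + G(x,y,t,D_x v,D_y v) = 0` on ℝⁿ×ℝ×(0,∞), `v(x,y,0) = v₀(x,y)`. -/
def IVPSol {n : ℕ} (G : Ham n) (v₀ : Dom2 n → ℝ) (v : Dom n → ℝ) : Prop :=
  ContinuousOn v {z : Dom n | 0 ≤ z.2.2} ∧
  (∀ x y, v (x, y, 0) = v₀ (x, y)) ∧
  ViscSubPos G v ∧ ViscSuperPos G v ∧
  (∀ T : ℝ, 0 < T →
    (∃ M, ∀ z : Dom n, 0 ≤ z.2.2 → z.2.2 ≤ T → |v z| ≤ M) ∧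
    UniformContinuousOn v {z : Dom n | 0 ≤ z.2.2 ∧ z.2.2 ≤ T})

/-- Viscosity subsolution of the eikonal-type inequality `w_t + c|D_x w| - C ≤ 0` on ℝⁿ×ℝ. -/
def ViscSubEik {n : ℕ} (c C : ℝ) (u : Dom2 n → ℝ) : Prop :=
  UpperSemicontinuous u ∧
  ∀ φ : Dom2 n → ℝ, ContDiff ℝ 1 φ → ∀ z : Dom2 n,
    IsLocalMax (fun w => u w - φ w) z →
    pdT2 φ z + c * ‖pdX2 φ z‖ - C ≤ 0

lemma lip_of_ae_deriv (f : ℝ → ℝ) (hf : LocallyLipschitz f) (a b L : ℝ)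
    (h : ∀ᵐ s : ℝ, s ∈ Set.uIcc a b → |deriv f s| ≤ L) : |f b - f a| ≤ L * |b - a| := by
  obtain ⟨K, hK⟩ := (hf.locallyLipschitzOn (s := Set.uIcc a b)).exists_lipschitzOnWith_of_compact
    isCompact_uIcc
  rw [← hK.absolutelyContinuousOnInterval.integral_deriv_eq_sub, ← Real.norm_eq_abs (∫ x in a..b, deriv f x)]
  apply intervalIntegral.norm_integral_le_of_norm_le_const_ae
  filter_upwards [h] with s hs hs'
  exact hs (Set.uIoc_subset_uIcc hs')

lemma gron (f : ℝ → ℝ) (hf : LocallyLipschitz f) (C A t h : ℝ) (hC : 0 ≤ C) (hA : 0 ≤ A)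
    (hh : C * |h| ≤ 1 / 2)
    (hd : ∀ᵐ s : ℝ, |deriv f s| ≤ C * (A + |f s|)) :
    |f (t + h) - f t| ≤ C * |h| * (2 * A + 2 * |f t|) := by
  obtain ⟨m, hm, hmax⟩ := (isCompact_uIcc (a := t) (b := t + h)).exists_isMaxOn
    (Set.nonempty_uIcc) (f := fun s => |f s|) (hf.continuous.abs.continuousOn)
  have key : ∀ s ∈ Set.uIcc t (t + h), |f s - f t| ≤ C * (A + |f m|) * |h| := by
    intro s hs
    have h1 := lip_of_ae_deriv f hf t s (C * (A + |f m|)) (by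
      filter_upwards [hd] with r hr hr'
      refine hr.trans ?_
      have : |f r| ≤ |f m| := hmax ((Set.uIcc_subset_uIcc Set.left_mem_uIcc hs) hr')
      gcongr)
    have h2 : |s - t| ≤ |h| := by
      have := Set.abs_sub_left_of_mem_uIcc hs
      simpa using this
    exact h1.trans (by gcongr)
  have hm1 := key m hm
  have hm2 : |f m| - |f t| ≤ |f m - f t| := abs_sub_abs_le_abs_sub _ _
  have h8 := key (t + h) Set.right_mem_uIcc
  refine h8.trans ?_
  have h9 : 0 ≤ C * |h| := by positivity
  have h10 : A + |f m| ≤ 2 * A + 2 * |f t| := by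
    have hA' : 0 ≤ A + |f m| := by positivity
    nlinarith
  nlinarith

lemma ae_line {E : Type*} [NormedAddCommGroup E] [NormedSpace ℝ E] [MeasurableSpace E]
    [BorelSpace E] [SecondCountableTopology E] (μ : Measure E) [SFinite μ]
    [μ.IsAddRightInvariant] (P : E → Prop) (h : ∀ᵐ ξ ∂μ, P ξ) (v : E) :
    ∀ᵐ ξ ∂μ, ∀ᵐ s : ℝ, P (ξ + s • v) := by
  obtain ⟨S, hS, hSm, hS0⟩ := exists_measurable_superset_of_null (ae_iff.1 h)
  have h1 : ∀ᵐ ξ ∂μ, ∀ᵐ s : ℝ, ξ + s • v ∈ Sᶜ := by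
    rw [Measure.ae_ae_comm]
    · refine Eventually.of_forall fun s => ?_
      rw [ae_iff]
      simp only [Set.mem_compl_iff, not_not]
      have := measure_preimage_add_right μ (s • v) S
      rw [hS0] at this
      exact this
    · have : Measurable (fun x : E × ℝ => x.1 + x.2 • v) := by fun_prop
      exact this hSm.compl
  filter_upwards [h1] with ξ hξ
  filter_upwards [hξ] with s hs
  by_contra hn
  exact hs (hS hn)

lemma haar_prod {E F : Type*} [NormedAddCommGroup E] [NormedSpace ℝ E] [MeasureSpace E]
    [BorelSpace E] [FiniteDimensional ℝ E] [NormedAddCommGroup F] [NormedSpace ℝ F]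
    [MeasureSpace F] [BorelSpace F] [FiniteDimensional ℝ F]
    [SFinite (volume : Measure E)] [SFinite (volume : Measure F)]
    (h1 : (volume : Measure E).IsAddHaarMeasure) (h2 : (volume : Measure F).IsAddHaarMeasure) :
    (volume : Measure (E × F)).IsAddHaarMeasure := by
  have := FiniteDimensional.proper ℝ E
  have : SecondCountableTopology E := inferInstance
  rw [Measure.volume_eq_prod]
  infer_instance

instance haarXi {n : ℕ} : (volume : Measure (Xi n)).IsAddHaarMeasure :=
  haar_prod inferInstance (haar_prod inferInstance (haar_prod inferInstance
    (haar_prod inferInstance inferInstance)))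

section
variable {n : ℕ} {G : Ham n} {l C₃ C₄ C₅ : ℝ}

lemma G_indep_y (h1 : HypH1 G) (h3 : HypH3 G l C₃ C₄ C₅) (x : Euc n) (y y' t : ℝ) (p : Euc n) :
    G x y t p (-l) = G x y' t p (-l) := by
  obtain ⟨_, _, _, hL, hae⟩ := h3
  have hc := h1.1
  have key : ∀ h : ℝ, ∀ ξ : Xi n, |G ξ.1 (ξ.2.1 + h) ξ.2.2.1 ξ.2.2.2.1 ξ.2.2.2.2
      - G ξ.1 ξ.2.1 ξ.2.2.1 ξ.2.2.2.1 ξ.2.2.2.2| ≤ C₃ * |ξ.2.2.2.2 + l| * |h| := by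
    intro h ξ
    have hl := ae_line (volume : Measure (Xi n)) _ hae ((0, 1, 0, 0, 0) : Xi n)
    have hd := Measure.dense_of_ae (p := fun ξ : Xi n =>
      |G ξ.1 (ξ.2.1 + h) ξ.2.2.1 ξ.2.2.2.1 ξ.2.2.2.2
      - G ξ.1 ξ.2.1 ξ.2.2.1 ξ.2.2.2.1 ξ.2.2.2.2| ≤ C₃ * |ξ.2.2.2.2 + l| * |h|)
      (μ := (volume : Measure (Xi n))) (by
        filter_upwards [hl] with ξ hξ
        have hlip : LocallyLipschitz (fun s : ℝ => G ξ.1 (ξ.2.1 + s) ξ.2.2.1 ξ.2.2.2.1 ξ.2.2.2.2) :=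
          (hL ξ.1 ξ.2.2.2.1).comp (g := fun s : ℝ => (ξ.2.1 + s, ξ.2.2.1, ξ.2.2.2.2))
            (ContDiff.locallyLipschitz (𝕂 := ℝ) (by fun_prop))
        have := lip_of_ae_deriv _ hlip 0 h (C₃ * |ξ.2.2.2.2 + l|) (by
          filter_upwards [hξ] with s hs _
          have := hs.1
          rw [deriv_comp_const_add (f := fun y => G ξ.1 y ξ.2.2.1 ξ.2.2.2.1 ξ.2.2.2.2)]
          simpa using this)
        simpa using this)
    have hcl : IsClosed {ξ : Xi n | |G ξ.1 (ξ.2.1 + h) ξ.2.2.1 ξ.2.2.2.1 ξ.2.2.2.2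
      - G ξ.1 ξ.2.1 ξ.2.2.1 ξ.2.2.2.1 ξ.2.2.2.2| ≤ C₃ * |ξ.2.2.2.2 + l| * |h|} := by
      have hc2 : Continuous (fun ξ : Xi n => G ξ.1 (ξ.2.1 + h) ξ.2.2.1 ξ.2.2.2.1 ξ.2.2.2.2) :=
        hc.comp (f := fun ξ : Xi n => ((ξ.1, ξ.2.1 + h, ξ.2.2.1, ξ.2.2.2.1, ξ.2.2.2.2) : Xi n))
          (by fun_prop)
      exact isClosed_le (hc2.sub hc).abs (by fun_prop)
    exact (hcl.closure_eq ▸ hd ξ : _)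
  have := key (y' - y) (x, y, t, p, -l)
  simp at this
  linarith

lemma G_lip_p (h1 : HypH1 G) (h3 : HypH3 G l C₃ C₄ C₅) (x : Euc n) (y t : ℝ) (p : Euc n)
    (r r' : ℝ) : |G x y t p r' - G x y t p r| ≤ C₅ * |r' - r| := by
  obtain ⟨_, _, _, hL, hae⟩ := h3
  have hc := h1.1
  have key : ∀ h : ℝ, ∀ ξ : Xi n, |G ξ.1 ξ.2.1 ξ.2.2.1 ξ.2.2.2.1 (ξ.2.2.2.2 + h)
      - G ξ.1 ξ.2.1 ξ.2.2.1 ξ.2.2.2.1 ξ.2.2.2.2| ≤ C₅ * |h| := by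
    intro h ξ
    have hl := ae_line (volume : Measure (Xi n)) _ hae ((0, 0, 0, 0, 1) : Xi n)
    have hd := Measure.dense_of_ae (p := fun ξ : Xi n =>
      |G ξ.1 ξ.2.1 ξ.2.2.1 ξ.2.2.2.1 (ξ.2.2.2.2 + h)
      - G ξ.1 ξ.2.1 ξ.2.2.1 ξ.2.2.2.1 ξ.2.2.2.2| ≤ C₅ * |h|)
      (μ := (volume : Measure (Xi n))) (by
        filter_upwards [hl] with ξ hξ
        have hlip : LocallyLipschitz (fun s : ℝ => G ξ.1 ξ.2.1 ξ.2.2.1 ξ.2.2.2.1 (ξ.2.2.2.2 + s)) :=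
          (hL ξ.1 ξ.2.2.2.1).comp (g := fun s : ℝ => (ξ.2.1, ξ.2.2.1, ξ.2.2.2.2 + s))
            (ContDiff.locallyLipschitz (𝕂 := ℝ) (by fun_prop))
        have := lip_of_ae_deriv _ hlip 0 h C₅ (by
          filter_upwards [hξ] with s hs _
          have := hs.2.2
          rw [deriv_comp_const_add (f := fun r => G ξ.1 ξ.2.1 ξ.2.2.1 ξ.2.2.2.1 r)]
          simpa using this)
        simpa using this)
    have hcl : IsClosed {ξ : Xi n | |G ξ.1 ξ.2.1 ξ.2.2.1 ξ.2.2.2.1 (ξ.2.2.2.2 + h)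
      - G ξ.1 ξ.2.1 ξ.2.2.1 ξ.2.2.2.1 ξ.2.2.2.2| ≤ C₅ * |h|} := by
      have hc2 : Continuous (fun ξ : Xi n => G ξ.1 ξ.2.1 ξ.2.2.1 ξ.2.2.2.1 (ξ.2.2.2.2 + h)) :=
        hc.comp (f := fun ξ : Xi n => ((ξ.1, ξ.2.1, ξ.2.2.1, ξ.2.2.2.1, ξ.2.2.2.2 + h) : Xi n))
          (by fun_prop)
      exact isClosed_le (hc2.sub hc).abs (by fun_prop)
    exact (hcl.closure_eq ▸ hd ξ : _)
  simpa using key (r' - r) (x, y, t, p, r)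

lemma G_lip_t (h1 : HypH1 G) (h3 : HypH3 G l C₃ C₄ C₅) (x : Euc n) (y t t' : ℝ) (p : Euc n)
    (r : ℝ) (hh : C₄ * |t' - t| ≤ 1 / 2) :
    |G x y t' p r - G x y t p r| ≤ C₄ * |t' - t| * (2 * (1 + |r|) + 2 * |G x y t p r|) := by
  obtain ⟨_, hC₄, _, hL, hae⟩ := h3
  have hc := h1.1
  have key : ∀ h : ℝ, C₄ * |h| ≤ 1 / 2 → ∀ ξ : Xi n,
      |G ξ.1 ξ.2.1 (ξ.2.2.1 + h) ξ.2.2.2.1 ξ.2.2.2.2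
      - G ξ.1 ξ.2.1 ξ.2.2.1 ξ.2.2.2.1 ξ.2.2.2.2| ≤
      C₄ * |h| * (2 * (1 + |ξ.2.2.2.2|) + 2 * |G ξ.1 ξ.2.1 ξ.2.2.1 ξ.2.2.2.1 ξ.2.2.2.2|) := by
    intro h hh ξ
    have hl := ae_line (volume : Measure (Xi n)) _ hae ((0, 0, 1, 0, 0) : Xi n)
    have hd := Measure.dense_of_ae (p := fun ξ : Xi n =>
      |G ξ.1 ξ.2.1 (ξ.2.2.1 + h) ξ.2.2.2.1 ξ.2.2.2.2
      - G ξ.1 ξ.2.1 ξ.2.2.1 ξ.2.2.2.1 ξ.2.2.2.2| ≤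
      C₄ * |h| * (2 * (1 + |ξ.2.2.2.2|) + 2 * |G ξ.1 ξ.2.1 ξ.2.2.1 ξ.2.2.2.1 ξ.2.2.2.2|))
      (μ := (volume : Measure (Xi n))) (by
        filter_upwards [hl] with ξ hξ
        have hlip : LocallyLipschitz (fun s : ℝ => G ξ.1 ξ.2.1 (ξ.2.2.1 + s) ξ.2.2.2.1 ξ.2.2.2.2) :=
          (hL ξ.1 ξ.2.2.2.1).comp (g := fun s : ℝ => (ξ.2.1, ξ.2.2.1 + s, ξ.2.2.2.2))
            (ContDiff.locallyLipschitz (𝕂 := ℝ) (by fun_prop))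
        have := gron _ hlip C₄ (1 + |ξ.2.2.2.2|) 0 h hC₄ (by positivity) hh (by
          filter_upwards [hξ] with s hs
          have := hs.2.1
          rw [deriv_comp_const_add (f := fun t => G ξ.1 ξ.2.1 t ξ.2.2.2.1 ξ.2.2.2.2)]
          simpa using this)
        simpa using this)
    have hcl : IsClosed {ξ : Xi n | |G ξ.1 ξ.2.1 (ξ.2.2.1 + h) ξ.2.2.2.1 ξ.2.2.2.2
      - G ξ.1 ξ.2.1 ξ.2.2.1 ξ.2.2.2.1 ξ.2.2.2.2| ≤
      C₄ * |h| * (2 * (1 + |ξ.2.2.2.2|) + 2 * |G ξ.1 ξ.2.1 ξ.2.2.1 ξ.2.2.2.1 ξ.2.2.2.2|)} := by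
      have hc2 : Continuous (fun ξ : Xi n => G ξ.1 ξ.2.1 (ξ.2.2.1 + h) ξ.2.2.2.1 ξ.2.2.2.2) :=
        hc.comp (f := fun ξ : Xi n => ((ξ.1, ξ.2.1, ξ.2.2.1 + h, ξ.2.2.2.1, ξ.2.2.2.2) : Xi n))
          (by fun_prop)
      exact isClosed_le (hc2.sub hc).abs (by fun_prop)
    exact (hcl.closure_eq ▸ hd ξ : _)
  simpa using key (t' - t) hh (x, y, t, p, r)

end
/-- quadratic test function -/
def tst {n : ℕ} (c A B : ℝ) (a : Euc n) (b : ℝ) : Dom n → ℝ := fun z =>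
  c * z.2.1 + A * ‖z.1 - a‖ ^ 2 + B * (z.2.2 - b) ^ 2

lemma tst_contDiff {n : ℕ} (c A B : ℝ) (a : Euc n) (b : ℝ) : ContDiff ℝ 1 (tst c A B a b) := by
  unfold tst
  have h1 : ContDiff ℝ 1 (fun z : Dom n => ‖z.1 - a‖ ^ 2) :=
    ContDiff.norm_sq ℝ (by fun_prop)
  have h2 : ContDiff ℝ 1 (fun z : Dom n => c * z.2.1) := by fun_prop
  have h3 : ContDiff ℝ 1 (fun z : Dom n => B * (z.2.2 - b) ^ 2) := by fun_prop
  exact (h2.add (contDiff_const.mul h1)).add h3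

lemma tst_line {n : ℕ} (c A B : ℝ) (a : Euc n) (b : ℝ) (z v : Dom n) :
    fderiv ℝ (tst c A B a b) z v =
      c * v.2.1 + 2 * A * inner ℝ (z.1 - a) v.1 + 2 * B * (z.2.2 - b) * v.2.2 := by
  have h0 : HasFDerivAt (fun w : Dom n => w.1 - a) (ContinuousLinearMap.fst ℝ (Euc n) (ℝ × ℝ)) z :=
    (hasFDerivAt_fst).sub_const a
  have hy : HasFDerivAt (fun w : Dom n => w.2.1)
      ((ContinuousLinearMap.fst ℝ ℝ ℝ).comp (ContinuousLinearMap.snd ℝ (Euc n) (ℝ × ℝ))) z :=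
    ((ContinuousLinearMap.fst ℝ ℝ ℝ).comp (ContinuousLinearMap.snd ℝ (Euc n) (ℝ × ℝ))).hasFDerivAt
  have ht : HasFDerivAt (fun w : Dom n => w.2.2 - b)
      ((ContinuousLinearMap.snd ℝ ℝ ℝ).comp (ContinuousLinearMap.snd ℝ (Euc n) (ℝ × ℝ))) z :=
    (((ContinuousLinearMap.snd ℝ ℝ ℝ).comp
      (ContinuousLinearMap.snd ℝ (Euc n) (ℝ × ℝ))).hasFDerivAt).sub_const b
  have h1 := ((hy.const_mul c).add (h0.norm_sq.const_mul A)).add ((ht.pow 2).const_mul B)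
  have h2 : HasFDerivAt (tst c A B a b) _ z := h1
  rw [h2.fderiv]
  simp [inner_sub_left]
  ring

lemma tst_pdT {n : ℕ} (c A B : ℝ) (a : Euc n) (b : ℝ) (z : Dom n) :
    pdT (tst c A B a b) z = 2 * B * (z.2.2 - b) := by
  simp [pdT, tst_line]

lemma tst_pdY {n : ℕ} (c A B : ℝ) (a : Euc n) (b : ℝ) (z : Dom n) :
    pdY (tst c A B a b) z = c := by
  simp [pdY, tst_line]

lemma tst_pdX {n : ℕ} (c A B : ℝ) (a : Euc n) (b : ℝ) (z : Dom n) :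
    pdX (tst c A B a b) z = (2 * A) • (z.1 - a) := by
  ext i
  simp [pdX, tst_line, EuclideanSpace.inner_single_right]

lemma per_int {n : ℕ} {w : Dom n → ℝ} (hper : STPeriodic w) (k : Fin n → ℤ) (a b : ℤ)
    (x : Euc n) (y t : ℝ) : w (x + intVec k, y + a, t + b) = w (x, y, t) := by
  obtain ⟨hx, hy, ht⟩ := hper
  rw [hx]
  have h1 : Function.Periodic (fun y => w (x, y, t + b)) 1 := fun y => hy x y _
  have h2 : Function.Periodic (fun t => w (x, y, t)) 1 := fun t => ht x y t
  have e1 := h1.int_mul a y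
  have e2 := h2.int_mul b t
  simp only [mul_one] at e1 e2
  rw [e1, e2]

lemma fund (n : ℕ) : ∃ R : ℝ, 0 < R ∧ ∀ (x : Euc n) (y t : ℝ), ∃ (k : Fin n → ℤ) (a b : ℤ),
    ‖((x + intVec k, y + a, t + b) : Dom n)‖ ≤ R := by
  have hc : IsCompact (((WithLp.toLp 2 : (Fin n → ℝ) → Euc n) ''
      (Set.pi Set.univ fun _ => Set.Icc (0 : ℝ) 1)) ×ˢ
      (Set.Icc (0 : ℝ) 1 ×ˢ Set.Icc (0 : ℝ) 1) : Set (Dom n)) := by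
    refine IsCompact.prod (IsCompact.image ?_ (PiLp.continuous_toLp 2 _))
      (isCompact_Icc.prod isCompact_Icc)
    exact isCompact_univ_pi fun _ => isCompact_Icc
  obtain ⟨R, hR⟩ := hc.isBounded.exists_norm_le
  refine ⟨max R 1, by positivity, fun x y t => ⟨fun i => -⌊x i⌋, -⌊y⌋, -⌊t⌋, ?_⟩⟩
  refine (hR _ ⟨?_, ?_, ?_⟩).trans (le_max_left _ _)
  · refine ⟨fun i => Int.fract (x i), ?_, ?_⟩
    · intro i _
      exact ⟨Int.fract_nonneg _, (Int.fract_lt_one _).le⟩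
    · ext i
      simp [intVec, Int.fract, sub_eq_add_neg]
  · have : y + ((-⌊y⌋ : ℤ) : ℝ) = Int.fract y := by simp [Int.fract, sub_eq_add_neg]
    simp only [this]
    exact ⟨Int.fract_nonneg _, (Int.fract_lt_one _).le⟩
  · have : t + ((-⌊t⌋ : ℤ) : ℝ) = Int.fract t := by simp [Int.fract, sub_eq_add_neg]
    simp only [this]
    exact ⟨Int.fract_nonneg _, (Int.fract_lt_one _).le⟩

lemma per_bdd {n : ℕ} {w : Dom n → ℝ} (hper : STPeriodic w) (hw : Continuous w) :
    ∃ K : ℝ, 0 < K ∧ ∀ z, |w z| ≤ K := by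
  obtain ⟨R, hR, hf⟩ := fund n
  obtain ⟨K, hK⟩ := (isCompact_closedBall (0 : Dom n) R).exists_bound_of_continuousOn hw.continuousOn
  refine ⟨max K 1, by positivity, fun ⟨x, y, t⟩ => ?_⟩
  obtain ⟨k, a, b, h⟩ := hf x y t
  rw [← per_int hper k a b x y t]
  exact (hK _ (by simpa using h)).trans (le_max_left _ _)

/-- the doubled function -/
def Phi {n : ℕ} (w : Dom n → ℝ) (l A B : ℝ) (z z' : Dom n) : ℝ :=
  w z - w z' + l * (z.2.1 - z'.2.1) - A * ‖z.1 - z'.1‖ ^ 2 - B * (z.2.2 - z'.2.2) ^ 2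

lemma exists_max {n : ℕ} {w : Dom n → ℝ} (hper : STPeriodic w) (hw : Continuous w)
    {K R : ℝ} (hK : ∀ z, |w z| ≤ K)
    (hf : ∀ (x : Euc n) (y t : ℝ), ∃ (k : Fin n → ℤ) (a b : ℤ),
      ‖((x + intVec k, y + a, t + b) : Dom n)‖ ≤ R)
    {l s A B : ℝ} (hs : s = 1 ∨ s = -1) (hsl : s * l < 0) (hA : 1 ≤ A) (hB : 1 ≤ B)
    (hne : ∃ z z' : Dom n, 0 ≤ s * (z.2.1 - z'.2.1) ∧ 0 ≤ Phi w l A B z z') :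
    ∃ z z' : Dom n, 0 ≤ s * (z.2.1 - z'.2.1) ∧ ‖z'‖ ≤ R ∧
      ∀ q q' : Dom n, 0 ≤ s * (q.2.1 - q'.2.1) → Phi w l A B q q' ≤ Phi w l A B z z' := by
  have hPc : Continuous (fun q : Dom n × Dom n => Phi w l A B q.1 q.2) := by
    unfold Phi
    fun_prop
  have hK0 : 0 ≤ K := (abs_nonneg _).trans (hK 0)
  have hlpos : 0 < |l| := abs_pos.2 (by rintro rfl; simp at hsl)
  have hll : ∀ d : ℝ, 0 ≤ s * d → l * d = - (|l| * |d|) := by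
    intro d hd
    rw [← abs_mul]
    have : l * d ≤ 0 := by rcases hs with rfl | rfl <;> nlinarith
    rw [abs_of_nonpos this]; ring
  set R1 : ℝ := R + (2 * K + 1) + 2 * K / |l| with hR1
  set S : Set (Dom n × Dom n) := (Metric.closedBall 0 R1 ×ˢ Metric.closedBall 0 R) ∩
    {q | 0 ≤ s * (q.1.2.1 - q.2.2.1)} with hS
  have hSc : IsCompact S := by
    refine ((isCompact_closedBall _ _).prod (isCompact_closedBall _ _)).inter_right ?_
    exact isClosed_le continuous_const (by fun_prop)
  -- reduction to the compact set
  have red : ∀ q q' : Dom n, 0 ≤ s * (q.2.1 - q'.2.1) → 0 ≤ Phi w l A B q q' →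
      ∃ r ∈ S, Phi w l A B r.1 r.2 = Phi w l A B q q' := by
    rintro ⟨x, y, t⟩ ⟨x', y', t'⟩ hq hP
    obtain ⟨k, a, b, h⟩ := hf x' y' t'
    refine ⟨((x + intVec k, y + a, t + b), (x' + intVec k, y' + a, t' + b)), ⟨⟨?_, ?_⟩, ?_⟩, ?_⟩
    · simp only [Phi] at hP hq
      rw [hll _ hq] at hP
      have e1 := abs_le.1 (hK (x, y, t))
      have e2 := abs_le.1 (hK (x', y', t'))
      have e3 : 0 ≤ ‖x - x'‖ ^ 2 := by positivity
      have e4 : 0 ≤ (t - t') ^ 2 := by positivity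
      have e5 : 0 ≤ |l| * |y - y'| := by positivity
      have d1 : ‖x - x'‖ ≤ 2 * K + 1 := by
        have : ‖x - x'‖ ^ 2 ≤ 2 * K := by nlinarith
        nlinarith [norm_nonneg (x - x')]
      have d2 : |t - t'| ≤ 2 * K + 1 := by
        have : |t - t'| ^ 2 ≤ 2 * K := by rw [sq_abs]; nlinarith
        nlinarith [abs_nonneg (t - t')]
      have d3 : |y - y'| ≤ 2 * K / |l| := by
        rw [le_div_iff₀ hlpos]; nlinarith
      have d4 : 0 ≤ 2 * K / |l| := by positivity
      have hd : ‖((x - x', y - y', t - t') : Dom n)‖ ≤ (2 * K + 1) + 2 * K / |l| := by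
        simp only [Prod.norm_def, Real.norm_eq_abs]
        refine max_le (by linarith) (max_le (by linarith) (by linarith))
      have : ((x + intVec k, y + a, t + b) : Dom n) =
          (x' + intVec k, y' + a, t' + b) + (x - x', y - y', t - t') := by
        simp only [Prod.mk_add_mk, Prod.mk.injEq]
        exact ⟨by abel, by ring, by ring⟩
      rw [mem_closedBall_zero_iff, this]
      exact (norm_add_le _ _).trans (by rw [hR1]; linarith)
    · simpa using h
    · simpa using hq
    · simp only [Phi, per_int hper]
      simp
  obtain ⟨z0, z0', h0, h0'⟩ := hne
  obtain ⟨r0, hr0, hr0'⟩ := red _ _ h0 h0'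
  obtain ⟨m, hm, hmax⟩ := hSc.exists_isMaxOn ⟨r0, hr0⟩ hPc.continuousOn
  refine ⟨m.1, m.2, hm.2, by simpa using hm.1.2, fun q q' hq => ?_⟩
  by_cases hP : 0 ≤ Phi w l A B q q'
  · obtain ⟨r, hr, hr'⟩ := red _ _ hq hP
    rw [← hr']
    exact hmax hr
  · push Not at hP
    have : Phi w l A B r0.1 r0.2 ≤ Phi w l A B m.1 m.2 := hmax hr0
    linarith

/-- viscosity inequalities at a maximum of `Phi` with strictly ordered `y`. -/
lemma visc_ineq {n : ℕ} {G : Ham n} {α : ℝ} {w : Dom n → ℝ} (hsol : ViscSol G α 0 w)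
    {l s A B : ℝ} {z z' : Dom n} (hz : 0 < s * (z.2.1 - z'.2.1))
    (hmax : ∀ q q' : Dom n, 0 ≤ s * (q.2.1 - q'.2.1) → Phi w l A B q q' ≤ Phi w l A B z z') :
    2 * B * (z.2.2 - z'.2.2) + G z.1 z.2.1 z.2.2 ((2 * A) • (z.1 - z'.1)) (-l) + α * w z ≤ 0 ∧
    0 ≤ 2 * B * (z.2.2 - z'.2.2) + G z'.1 z'.2.1 z'.2.2 ((2 * A) • (z.1 - z'.1)) (-l)
      + α * w z' := by
  obtain ⟨hw, hsub, hsup⟩ := hsol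
  constructor
  · have := hsub.2 (tst (-l) A B z'.1 z'.2.2) (tst_contDiff _ _ _ _ _) z (by
      have hev : ∀ᶠ q : Dom n in 𝓝 z, 0 < s * (q.2.1 - z'.2.1) :=
        (by fun_prop : Continuous fun q : Dom n => s * (q.2.1 - z'.2.1)).continuousAt.eventually
          (lt_mem_nhds hz)
      filter_upwards [hev] with q hq
      have := hmax q z' hq.le
      simp only [Phi, tst] at this ⊢
      linarith)
    rwa [tst_pdT, tst_pdX, tst_pdY] at this
  · have := hsup.2 (tst (-l) (-A) (-B) z.1 z.2.2) (tst_contDiff _ _ _ _ _) z' (by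
      have hev : ∀ᶠ q : Dom n in 𝓝 z', 0 < s * (z.2.1 - q.2.1) :=
        (by fun_prop : Continuous fun q : Dom n => s * (z.2.1 - q.2.1)).continuousAt.eventually
          (lt_mem_nhds hz)
      filter_upwards [hev] with q hq
      have := hmax z q hq.le
      simp only [Phi, tst] at this ⊢
      rw [norm_sub_rev z.1 q.1, norm_sub_rev z.1 z'.1] at this
      linarith)
    rw [tst_pdT, tst_pdX, tst_pdY] at this
    have e : (2 * -A) • (z'.1 - z.1) = (2 * A) • (z.1 - z'.1) := by
      rw [← neg_sub z.1 z'.1, smul_neg, mul_neg, neg_smul, neg_neg]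
    rw [e] at this
    linarith

lemma exists_big (K θ : ℝ) (hK : 0 < K) (hθ : 0 < θ) : ∃ A : ℝ, 1 ≤ A ∧ 2 * K ≤ A * θ ^ 2 := by
  refine ⟨max 1 (2 * K / θ ^ 2), le_max_left _ _, ?_⟩
  have := le_max_right 1 (2 * K / θ ^ 2)
  rwa [div_le_iff₀ (by positivity)] at this

lemma le_of_pen {A K θ d : ℝ} (hA : 1 ≤ A) (hθ : 0 < θ) (hb : 2 * K ≤ A * θ ^ 2)
    (h : A * d ^ 2 ≤ 2 * K) : d ≤ θ := by
  have : d ^ 2 ≤ θ ^ 2 := by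
    have := h.trans hb
    exact le_of_mul_le_mul_left this (by linarith)
  exact (abs_le_of_sq_le_sq' this hθ.le).2

set_option maxHeartbeats 1600000 in
lemma core {n : ℕ} (G : Ham n) (C₁ C₂ l C₃ C₄ C₅ : ℝ)
    (h1 : HypH1 G) (h2 : HypH2 G C₁ C₂) (h3 : HypH3 G l C₃ C₄ C₅)
    (α : ℝ) (hα : 0 < α) (w : Dom n → ℝ) (hper : STPeriodic w) (hsol : ViscSol G α 0 w)
    (s : ℝ) (hs : s = 1 ∨ s = -1) (hsl : s * l < 0) (x : Euc n) (t y y' : ℝ)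
    (hy : 0 ≤ s * (y - y')) : w (x, y, t) + l * y ≤ w (x, y', t) + l * y' := by
  have hw : Continuous w := hsol.1
  obtain ⟨K, hKpos, hK⟩ := per_bdd hper hw
  obtain ⟨R, hR, hf⟩ := fund n
  have hneg : ∀ d : ℝ, 0 ≤ s * d → l * d ≤ 0 := by
    intro d hd
    rcases hs with rfl | rfl <;> nlinarith
  by_contra hcon
  push Not at hcon
  set V : Set ℝ := {m | ∃ (x : Euc n) (t y y' : ℝ), 0 ≤ s * (y - y') ∧
    m = w (x, y, t) - w (x, y', t) + l * (y - y')} with hV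
  have hVb : BddAbove V := by
    refine ⟨2 * K, ?_⟩
    rintro m ⟨x, t, y, y', hyy, rfl⟩
    have e1 := abs_le.1 (hK (x, y, t))
    have e2 := abs_le.1 (hK (x, y', t))
    have := hneg _ hyy
    linarith
  set M := sSup V with hM
  have hVM : ∀ (x : Euc n) (t y y' : ℝ), 0 ≤ s * (y - y') →
      w (x, y, t) - w (x, y', t) + l * (y - y') ≤ M :=
    fun x t y y' h => le_csSup hVb ⟨x, t, y, y', h, rfl⟩
  have hVn : V.Nonempty := ⟨_, x, t, y, y', hy, rfl⟩
  have hMpos : 0 < M := by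
    have := hVM x t y y' hy
    linarith
  obtain ⟨hC₁, hC₂, hcoer⟩ := h2
  have hC₄ : 0 ≤ C₄ := h3.2.1
  have hC₅ : 0 ≤ C₅ := h3.2.2.1
  -- constants
  set Q : ℝ := α * K + C₂ + C₅ * |l| with hQ
  have hQpos : 0 < Q := by positivity
  obtain ⟨κ, hκ, hκM, hκ4⟩ : ∃ κ : ℝ, 0 < κ ∧ κ < M ∧ C₄ * (4 * κ) ≤ α * M / 4 := by
    refine ⟨min (M / 2) (α * M / 4 / (4 * (C₄ + 1))), by positivity,
      (min_le_left _ _).trans_lt (by linarith), ?_⟩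
    have := min_le_right (M / 2) (α * M / 4 / (4 * (C₄ + 1)))
    rw [le_div_iff₀ (by positivity)] at this
    have h0 : 0 < min (M / 2) (α * M / 4 / (4 * (C₄ + 1))) := by positivity
    nlinarith
  obtain ⟨θ₀, hθ₀, hθw⟩ := Metric.uniformContinuousOn_iff.1
    ((isCompact_closedBall (0 : Dom n) (R + 1)).uniformContinuousOn_of_continuous
      hw.continuousOn) κ hκ
  obtain ⟨θ, hθ, hθ0, hθ1, hθ2, hθ3⟩ : ∃ θ : ℝ, 0 < θ ∧ θ < θ₀ ∧ θ ≤ 1 ∧ C₄ * θ ≤ 1 / 2 ∧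
      C₄ * ((2 + 2 * |l| + 2 * Q) * θ) ≤ α * M / 4 := by
    set D := C₄ * (2 + 2 * |l| + 2 * Q) with hD
    have hD0 : 0 ≤ D := by positivity
    refine ⟨min (min (θ₀ / 2) 1) (min (1 / 2 / (C₄ + 1)) (α * M / 4 / (D + 1))),
      by positivity, ?_, ?_, ?_, ?_⟩
    · exact ((min_le_left _ _).trans (min_le_left _ _)).trans_lt (by linarith)
    · exact (min_le_left _ _).trans (min_le_right _ _)
    · have := (min_le_right (min (θ₀ / 2) 1) (min (1 / 2 / (C₄ + 1)) (α * M / 4 / (D + 1)))).trans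
        (min_le_left _ _)
      rw [le_div_iff₀ (by positivity)] at this
      have h0 : 0 < min (min (θ₀ / 2) 1) (min (1 / 2 / (C₄ + 1)) (α * M / 4 / (D + 1))) := by
        positivity
      nlinarith
    · have := (min_le_right (min (θ₀ / 2) 1) (min (1 / 2 / (C₄ + 1)) (α * M / 4 / (D + 1)))).trans
        (min_le_right _ _)
      rw [le_div_iff₀ (by positivity)] at this
      have h0 : 0 < min (min (θ₀ / 2) 1) (min (1 / 2 / (C₄ + 1)) (α * M / 4 / (D + 1))) := by
        positivity
      rw [← mul_assoc, ← hD]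
      nlinarith
  obtain ⟨B, hB, hBθ⟩ := exists_big K θ hKpos hθ
  set Rp : ℝ := (2 * B * θ + Q) / C₁ with hRp
  have hRp0 : 0 < Rp := by positivity
  obtain ⟨θ', hθ', hθG⟩ := Metric.uniformContinuousOn_iff.1
    ((isCompact_closedBall (0 : Xi n) (R + 1 + Rp + |l|)).uniformContinuousOn_of_continuous
      h1.1.continuousOn) (α * M / 4) (by positivity)
  obtain ⟨A, hA, hAθ⟩ := exists_big K (min θ (θ' / 2)) hKpos (by positivity)
  -- the maximum point
  have hPhi : ∀ (x : Euc n) (t y y' : ℝ), Phi w l A B (x, y, t) (x, y', t) =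
      w (x, y, t) - w (x, y', t) + l * (y - y') := by
    intro x t y y'; simp [Phi]
  obtain ⟨z, z', hzz, hz'R, hmax⟩ := exists_max hper hw hK hf hs hsl hA hB
    ⟨(x, y, t), (x, y', t), hy, by rw [hPhi]; linarith⟩
  have hPM : M ≤ Phi w l A B z z' := by
    refine csSup_le hVn ?_
    rintro m ⟨x, t, y, y', hyy, rfl⟩
    rw [← hPhi]
    exact hmax _ _ hyy
  obtain ⟨x₁, y₁, t₁⟩ := z
  obtain ⟨x₂, y₂, t₂⟩ := z'
  simp only at hzz
  have hP := hPM
  simp only [Phi] at hP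
  have e1 := abs_le.1 (hK (x₁, y₁, t₁))
  have e2 := abs_le.1 (hK (x₂, y₂, t₂))
  have e3 := hneg _ hzz
  have pA : 0 ≤ A * ‖x₁ - x₂‖ ^ 2 := by positivity
  have pB : 0 ≤ B * (t₁ - t₂) ^ 2 := by positivity
  have dx := le_of_pen hA (by positivity) hAθ (d := ‖x₁ - x₂‖) (by linarith)
  have dt := le_of_pen hB hθ hBθ (d := |t₁ - t₂|) (by rw [sq_abs]; linarith)
  have dx1 : ‖x₁ - x₂‖ ≤ θ := dx.trans (min_le_left _ _)
  have dx2 : ‖x₁ - x₂‖ < θ' := (dx.trans (min_le_right _ _)).trans_lt (by linarith)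
  simp only [Prod.norm_def, Real.norm_eq_abs, sup_le_iff] at hz'R
  obtain ⟨nx₂, ny₂, nt₂⟩ := hz'R
  have nx₁ : ‖x₁‖ ≤ R + 1 := by
    have := norm_sub_norm_le x₁ x₂
    linarith
  have nt₁ : |t₁| ≤ R + 1 := by
    have := abs_sub_abs_le_abs_sub t₁ t₂
    linarith
  have hwκ : w (x₁, y₂, t₁) - w (x₂, y₂, t₂) < κ := by
    have := hθw (x₁, y₂, t₁) (by
        simp only [mem_closedBall_zero_iff, Prod.norm_def, Real.norm_eq_abs, sup_le_iff]
        exact ⟨nx₁, by linarith, nt₁⟩) (x₂, y₂, t₂) (by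
        simp only [mem_closedBall_zero_iff, Prod.norm_def, Real.norm_eq_abs, sup_le_iff]
        exact ⟨by linarith, by linarith, by linarith⟩) (by
        simp only [Prod.dist_eq, dist_self]
        rw [dist_eq_norm, Real.dist_eq]
        refine max_lt (by linarith) (max_lt hθ₀ (by linarith)))
    rw [Real.dist_eq] at this
    exact (abs_lt.1 this).2
  have hpen : B * (t₁ - t₂) ^ 2 ≤ κ := by
    have := hVM x₁ t₁ y₁ y₂ hzz
    linarith
  have hstrict : 0 < s * (y₁ - y₂) := by
    refine lt_of_le_of_ne hzz fun h0 => ?_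
    have : y₁ = y₂ := by
      rcases hs with rfl | rfl <;> linarith
    subst this
    linarith
  obtain ⟨hv1, hv2⟩ := visc_ineq hsol hstrict hmax
  simp only at hv1 hv2
  set p : Euc n := (2 * A) • (x₁ - x₂) with hp
  set h : ℝ := |t₁ - t₂| with hh
  have hh0 : 0 ≤ h := abs_nonneg _
  have hBq : |2 * B * (t₁ - t₂)| = 2 * B * h := by
    rw [abs_mul, abs_of_pos (by linarith : 0 < 2 * B)]
  have hBh : B * h ^ 2 ≤ κ := by rw [hh, sq_abs]; exact hpen
  have hq := abs_le.1 hBq.le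
  -- bounds on g
  have gl : C₁ * ‖p‖ - C₂ - C₅ * |l| ≤ G x₁ y₁ t₁ p (-l) := by
    have a1 := hcoer x₁ y₁ t₁ p
    have a2 := G_lip_p h1 h3 x₁ y₁ t₁ p 0 (-l)
    rw [sub_zero, abs_neg] at a2
    have := (abs_le.1 a2).1
    linarith
  have αK1 : -(α * K) ≤ α * w (x₁, y₁, t₁) := by
    have := mul_le_mul_of_nonneg_left e1.1 hα.le
    linarith
  have gu : G x₁ y₁ t₁ p (-l) ≤ 2 * B * h + α * K := by linarith
  have hpR : ‖p‖ ≤ Rp := by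
    rw [hRp, le_div_iff₀ hC₁]
    have : 2 * B * h ≤ 2 * B * θ := by gcongr
    linarith
  have gabs : |G x₁ y₂ t₁ p (-l)| ≤ 2 * B * h + Q := by
    rw [G_indep_y h1 h3 x₁ y₂ y₁ t₁ p]
    have : 0 ≤ C₁ * ‖p‖ := by positivity
    have : 0 ≤ B * h := by positivity
    have : 0 ≤ α * K := by positivity
    have : 0 ≤ C₅ * |l| := by positivity
    rw [abs_le]
    constructor <;> linarith
  have gt : |G x₁ y₂ t₂ p (-l) - G x₁ y₂ t₁ p (-l)| ≤ α * M / 2 := by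
    have hts : |t₂ - t₁| = h := abs_sub_comm _ _
    have := G_lip_t h1 h3 x₁ y₂ t₁ t₂ p (-l) (by
      rw [hts]; exact (mul_le_mul_of_nonneg_left dt hC₄).trans hθ2)
    rw [hts, abs_neg] at this
    refine this.trans ?_
    calc C₄ * h * (2 * (1 + |l|) + 2 * |G x₁ y₂ t₁ p (-l)|)
        ≤ C₄ * h * (2 * (1 + |l|) + 2 * (2 * B * h + Q)) := by gcongr
      _ = C₄ * ((2 + 2 * |l| + 2 * Q) * h) + C₄ * (4 * (B * h ^ 2)) := by ring
      _ ≤ C₄ * ((2 + 2 * |l| + 2 * Q) * θ) + C₄ * (4 * κ) := by gcongr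
      _ ≤ α * M / 2 := by linarith
  have gx : G x₂ y₂ t₂ p (-l) - G x₁ y₂ t₂ p (-l) < α * M / 4 := by
    have hl0 := abs_nonneg l
    have := hθG (x₂, y₂, t₂, p, -l) (by
        simp only [mem_closedBall_zero_iff, Prod.norm_def, Real.norm_eq_abs, sup_le_iff, abs_neg]
        exact ⟨by linarith, by linarith, by linarith, by linarith, by linarith⟩)
      (x₁, y₂, t₂, p, -l) (by
        simp only [mem_closedBall_zero_iff, Prod.norm_def, Real.norm_eq_abs, sup_le_iff, abs_neg]
        exact ⟨by linarith, by linarith, by linarith, by linarith, by linarith⟩) (by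
        simp only [Prod.dist_eq, dist_self]
        rw [dist_eq_norm, norm_sub_rev]
        simpa using dx2)
    rw [Real.dist_eq] at this
    exact (abs_lt.1 this).2
  have gy := G_indep_y h1 h3 x₁ y₁ y₂ t₁ p
  have gt' := (abs_le.1 gt).2
  have hfin : α * M ≤ α * (w (x₁, y₁, t₁) - w (x₂, y₂, t₂)) := by
    apply mul_le_mul_of_nonneg_left _ hα.le
    linarith
  have : 0 < α * M := by positivity
  linarith

/-- Under (H1)–(H3), for any continuous space-time periodic viscosity
solution w^α of `w_t + G + α w = 0` (α > 0) : if l < 0 then y ↦ w^α(x,y,t) + l y is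
nonincreasing, and if l > 0 it is nondecreasing, for every fixed (x,t). -/
theorem statement9 {n : ℕ} (hn : 0 < n) (G : Ham n) (C₁ C₂ l C₃ C₄ C₅ : ℝ)
    (h1 : HypH1 G) (h2 : HypH2 G C₁ C₂) (h3 : HypH3 G l C₃ C₄ C₅)
    (α : ℝ) (hα : 0 < α) (w : Dom n → ℝ) (hper : STPeriodic w) (hsol : ViscSol G α 0 w) :
    (l < 0 → ∀ (x : Euc n) (t : ℝ), Antitone fun y : ℝ => w (x, y, t) + l * y) ∧
    (0 < l → ∀ (x : Euc n) (t : ℝ), Monotone fun y : ℝ => w (x, y, t) + l * y) := by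
  refine ⟨fun hl x t y y' hyy => ?_, fun hl x t y y' hyy => ?_⟩
  · exact core G C₁ C₂ l C₃ C₄ C₅ h1 h2 h3 α hα w hper hsol 1 (Or.inl rfl) (by linarith) x t y' y
      (by linarith)
  · exact core G C₁ C₂ l C₃ C₄ C₅ h1 h2 h3 α hα w hper hsol (-1) (Or.inr rfl) (by linarith) x t y y'
      (by linarith)
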